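/- Let L ≥ 2 and consider the periodic chain of L qubits. Define Z_x by Z_x|b⟩ = (−1)^{b_x}|b⟩, the total charge Q = Σ_{x∈ZMod L} Z_x, the global spin flip F by (Fψ)(b) = ψ(¬b), and the translation T by (Tψ)(b) = ψ(i ↦ b_{i+1}). Then there is no positive semidefinite operator ρ with trace 1 on the chain Hilbert space satisfying all of: (i) Q ρ = 0; (ii) T ρ T† = ρ; (iii) F ρ = λ ρ for some λ ∈ ℂ; and (iv) ρ = Σ_i p_i |ψ_i⟩⟨ψ_i| with finitely many terms, p_i > 0, and each ψ_i separable with respect to a partition of ZMod L into two disjoint nonempty contiguous arcs A and B. -/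

import Mathlib

open Matrix ComplexOrder

/-- The rank-one operator `|ψ⟩⟨ψ| : v ↦ ⟨ψ, v⟩ ψ`, as a matrix. -/
noncomputable def outer {ι : Type*} [Fintype ι] (ψ : ι → ℂ) : Matrix ι ι ℂ :=
  Matrix.of fun i j => ψ i * (starRingEnd ℂ) (ψ j)

/-- The total charge `Q = Σ_x Z_x`, where `Z_x|b⟩ = (−1)^{b_x}|b⟩`. -/
noncomputable def chargeQ (L : ℕ) [NeZero L] :
    Matrix (ZMod L → Bool) (ZMod L → Bool) ℂ :=
  Matrix.diagonal fun b => ∑ x : ZMod L, (if b x then (-1 : ℂ) else 1)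

/-- The global spin flip `F`: `(Fψ)(b) = ψ(¬b)`. -/
noncomputable def flipF (L : ℕ) [NeZero L] :
    Matrix (ZMod L → Bool) (ZMod L → Bool) ℂ :=
  Matrix.of fun b b' => if b' = (fun i => ! b i) then 1 else 0

/-- The translation `T`: `(Tψ)(b) = ψ(i ↦ b_{i+1})`. -/
noncomputable def transT (L : ℕ) [NeZero L] :
    Matrix (ZMod L → Bool) (ZMod L → Bool) ℂ :=
  Matrix.of fun b b' => if b' = (fun i => b (i + 1)) then 1 else 0

/-- A contiguous arc `{j, j+1, …, j+m−1}` in `ZMod L`. -/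
def IsArc {L : ℕ} (A : Set (ZMod L)) : Prop :=
  ∃ (j : ZMod L) (m : ℕ), A = {x | ∃ k, k < m ∧ x = j + (k : ZMod L)}

/-- A vector of the chain Hilbert space separable with respect to the bipartition
`{A, B}`: `ψ(b) = f(b|_A) g(b|_B)`. -/
def SepVec2 {L : ℕ} (A B : Set (ZMod L)) (ψ : (ZMod L → Bool) → ℂ) : Prop :=
  ∃ (f : (A → Bool) → ℂ) (g : (B → Bool) → ℂ),
    ∀ b, ψ b = f (fun x => b x.1) * g (fun x => b x.1)

/-- A positive combination of squared moduli vanishes only if every term does. -/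
theorem eq_zero_of_sum_mul_conj_eq_zero {n : ℕ} {p : Fin n → ℝ} (hp : ∀ i, 0 < p i)
    (z : Fin n → ℂ) (h : ∑ i, (p i : ℂ) * (z i * (starRingEnd ℂ) (z i)) = 0) (i : Fin n) :
    z i = 0 := by
  have h' : ∑ i, p i * Complex.normSq (z i) = 0 := by
    have : ((∑ i, p i * Complex.normSq (z i) : ℝ) : ℂ) = 0 := by
      rw [← h]
      push_cast
      exact Finset.sum_congr rfl fun i _ => by rw [Complex.mul_conj]
    exact_mod_cast this
  have hi := (Finset.sum_eq_zero_iff_of_nonneg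
    (fun i _ => mul_nonneg (hp i).le (Complex.normSq_nonneg (z i)))).1 h' i (Finset.mem_univ i)
  exact Complex.normSq_eq_zero.1 ((mul_eq_zero.1 hi).resolve_left (hp i).ne')

theorem sum_smul_outer_apply {ι : Type*} [Fintype ι] {n : ℕ} (p : Fin n → ℝ)
    (ψ : Fin n → ι → ℂ) (a b : ι) :
    (∑ i, (p i : ℂ) • outer (ψ i)) a b =
      ∑ i, (p i : ℂ) * (ψ i a * (starRingEnd ℂ) (ψ i b)) := by
  simp [Matrix.sum_apply, outer]

theorem flipF_mul_apply {L : ℕ} [NeZero L] (ρ : Matrix (ZMod L → Bool) (ZMod L → Bool) ℂ)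
    (b b' : ZMod L → Bool) : (flipF L * ρ) b b' = ρ (fun i => ! b i) b' := by
  simp [flipF, Matrix.mul_apply]

theorem transT_conj_apply {L : ℕ} [NeZero L] (ρ : Matrix (ZMod L → Bool) (ZMod L → Bool) ℂ)
    (b b' : ZMod L → Bool) :
    (transT L * ρ * (transT L)ᴴ) b b' = ρ (fun i => b (i + 1)) (fun i => b' (i + 1)) := by
  simp [transT, Matrix.mul_apply, Matrix.conjTranspose_apply, apply_ite]

/-- The eigenvalue of `Z` on a computational basis state. -/
noncomputable def spinSign (b : Bool) : ℂ := if b then -1 else 1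

theorem spinSign_not (b : Bool) : spinSign (!b) = - spinSign b := by
  cases b <;> simp [spinSign]

theorem spinSign_injective : Function.Injective spinSign := by
  intro a b h
  cases a <;> cases b <;> first | rfl | (norm_num [spinSign] at h)

theorem chargeQ_mul_apply {L : ℕ} [NeZero L] (ρ : Matrix (ZMod L → Bool) (ZMod L → Bool) ℂ)
    (b b' : ZMod L → Bool) : (chargeQ L * ρ) b b' = (∑ x, spinSign (b x)) * ρ b b' := by
  simp [chargeQ, Matrix.diagonal_mul, spinSign]

/-- The support of a separable vector is a product set. -/
theorem SepVec2.piecewise_ne_zero {L : ℕ} {A B : Set (ZMod L)} {ψ : (ZMod L → Bool) → ℂ}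
    (h : SepVec2 A B ψ) (hAB : Disjoint A B) [DecidablePred (· ∈ A)] {b b' : ZMod L → Bool}
    (hb : ψ b ≠ 0) (hb' : ψ b' ≠ 0) : ψ (fun x => if x ∈ A then b x else b' x) ≠ 0 := by
  obtain ⟨f, g, hfg⟩ := h
  rw [hfg] at hb hb' ⊢
  have hA : (fun x : A => if x.1 ∈ A then b x.1 else b' x.1) = fun x : A => b x.1 := by
    funext x
    simp [x.2]
  have hB : (fun x : B => if x.1 ∈ A then b x.1 else b' x.1) = fun x : B => b' x.1 := by
    funext x
    simp [hAB.notMem_of_mem_right x.2]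
  rw [hA, hB]
  exact mul_ne_zero (left_ne_zero_of_mul hb) (right_ne_zero_of_mul hb')

/-- A proper nonempty arc has a first site `j` in it and a first site `j + m` beyond it, and
translating a sum over the arc by one site trades the former for the latter. -/
theorem IsArc.exists_sum_shift_sub {L : ℕ} [NeZero L] {A : Set (ZMod L)} (hA : IsArc A)
    (hne : A.Nonempty) (hproper : A ≠ Set.univ) [DecidablePred (· ∈ A)] :
    ∃ j ∈ A, ∃ l ∉ A, ∀ h : ZMod L → ℂ,
      (∑ x with x ∈ A, h (x + 1)) - ∑ x with x ∈ A, h x = h l - h j := by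
  obtain ⟨j, m, rfl⟩ := hA
  have hmL : m < L := by
    by_contra! hm
    refine hproper (Set.eq_univ_of_forall fun x => ⟨(x - j).val, ?_, ?_⟩)
    · exact (ZMod.val_lt _).trans_le hm
    · rw [ZMod.natCast_zmod_val]; ring
  have hm0 : 0 < m := by
    obtain ⟨x, k, hk, -⟩ := hne
    omega
  have hinj : ∀ k l : ℕ, k < L → l < L → (k : ZMod L) = l → k = l := by
    intro k l hk hl h
    rw [ZMod.natCast_eq_natCast_iff'] at h
    rwa [Nat.mod_eq_of_lt hk, Nat.mod_eq_of_lt hl] at h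
  have hsum : ∀ h : ZMod L → ℂ,
      ∑ x with x ∈ {x : ZMod L | ∃ k, k < m ∧ x = j + (k : ZMod L)}, h x =
        ∑ k ∈ Finset.range m, h (j + (k : ZMod L)) := by
    intro h
    symm
    refine Finset.sum_bij (fun k _ => j + (k : ZMod L)) ?_ ?_ ?_ ?_
    · intro k hk
      simpa using ⟨k, Finset.mem_range.1 hk, rfl⟩
    · intro k hk l hl hkl
      exact hinj k l ((Finset.mem_range.1 hk).trans hmL) ((Finset.mem_range.1 hl).trans hmL)
        (add_left_cancel hkl)
    · intro x hx
      obtain ⟨k, hk, rfl⟩ := (Finset.mem_filter.1 hx).2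
      exact ⟨k, Finset.mem_range.2 hk, rfl⟩
    · intros
      rfl
  refine ⟨j, ⟨0, hm0, by simp⟩, j + (m : ZMod L), ?_, fun h => ?_⟩
  · rintro ⟨k, hk, hjk⟩
    have := hinj m k hmL (hk.trans hmL) (add_left_cancel hjk)
    omega
  · rw [hsum h, hsum fun x => h (x + 1), ← Finset.sum_sub_distrib]
    have := Finset.sum_range_sub (fun k : ℕ => h (j + (k : ZMod L))) m
    simpa [add_assoc] using this

/-- If the flip acts on a mixture as a scalar, it acts on every component as that scalar. -/
theorem apply_not_eq_of_flipF_mul_eq {L : ℕ} [NeZero L] {n : ℕ} {p : Fin n → ℝ}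
    (hp : ∀ i, 0 < p i) {ψ : Fin n → (ZMod L → Bool) → ℂ} {lam : ℂ}
    (hF : flipF L * (∑ i, (p i : ℂ) • outer (ψ i)) = lam • ∑ i, (p i : ℂ) • outer (ψ i))
    (i : Fin n) (b : ZMod L → Bool) : ψ i (fun x => ! b x) = lam * ψ i b := by
  have key : ∀ b', ∑ i, (p i : ℂ) * (ψ i (fun x => ! b x) * (starRingEnd ℂ) (ψ i b')) =
      lam * ∑ i, (p i : ℂ) * (ψ i b * (starRingEnd ℂ) (ψ i b')) := by
    intro b'
    have := congrFun (congrFun hF b) b'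
    rwa [flipF_mul_apply, Matrix.smul_apply, sum_smul_outer_apply, sum_smul_outer_apply,
      smul_eq_mul] at this
  refine sub_eq_zero.1 (eq_zero_of_sum_mul_conj_eq_zero hp
    (fun i => ψ i (fun x => ! b x) - lam * ψ i b) ?_ i)
  have h1 := key (fun x => ! b x)
  have h2 := key b
  rw [← sub_eq_zero, Finset.mul_sum, ← Finset.sum_sub_distrib] at h1 h2
  have h3 := congrArg₂ (fun x y => x - (starRingEnd ℂ) lam * y) h1 h2
  simp only [mul_zero, sub_zero, Finset.mul_sum] at h3
  rw [← Finset.sum_sub_distrib] at h3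
  rw [← h3]
  refine Finset.sum_congr rfl fun i _ => ?_
  rw [map_sub, map_mul]
  ring

/-- Lieb–Schultz–Mattis obstruction to bipartite separability: no density matrix on the
spin-1/2 chain can simultaneously have zero total charge (`Qρ = 0`), weak translation
symmetry (`TρT† = ρ`), strong spin-flip symmetry (`Fρ = λρ`), and a bipartite separable
decomposition with respect to a partition into two contiguous arcs. -/
theorem lsm_no_bipartite_separable_symmetric_state
    (L : ℕ) [NeZero L] (hL : 2 ≤ L)
    (A B : Set (ZMod L)) (hA : IsArc A) (hB : IsArc B)
    (hAne : A.Nonempty) (hBne : B.Nonempty)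
    (hAB : Disjoint A B) (hUnion : A ∪ B = Set.univ)
    (ρ : Matrix (ZMod L → Bool) (ZMod L → Bool) ℂ)
    (hpsd : ρ.PosSemidef) (htr : ρ.trace = 1)
    (hQ : chargeQ L * ρ = 0)
    (hT : transT L * ρ * (transT L)ᴴ = ρ)
    (lam : ℂ) (hF : flipF L * ρ = lam • ρ)
    (n : ℕ) (p : Fin n → ℝ) (hp : ∀ i, 0 < p i)
    (ψ : Fin n → (ZMod L → Bool) → ℂ)
    (hsep : ∀ i, SepVec2 A B (ψ i))
    (hdecomp : ρ = ∑ i, (p i : ℂ) • outer (ψ i)) : False := by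
  classical
  have hdiag : ∀ b, ρ b b ≠ 0 ↔ ∃ i, ψ i b ≠ 0 := by
    intro b
    rw [hdecomp, sum_smul_outer_apply]
    constructor
    · contrapose!
      intro h
      simp [h]
    · rintro ⟨i, hi⟩ h
      exact hi (eq_zero_of_sum_mul_conj_eq_zero hp (fun i => ψ i b) h i)
  have hcharge : ∀ b i, ψ i b ≠ 0 → ∑ x, spinSign (b x) = 0 := by
    intro b i hi
    have h := congrFun (congrFun hQ b) b
    rw [chargeQ_mul_apply] at h
    exact (mul_eq_zero.1 h).resolve_right ((hdiag b).2 ⟨i, hi⟩)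
  have hflip : ∀ i b, ψ i (fun x => ! b x) = lam * ψ i b :=
    apply_not_eq_of_flipF_mul_eq hp (hdecomp ▸ hF)
  have hswap : ∀ i b, ψ i b ≠ 0 → ψ i (fun x => if x ∈ A then ! b x else b x) ≠ 0 := by
    intro i b hb
    refine (hsep i).piecewise_ne_zero hAB (b := fun x => ! b x) (fun h => hb ?_) hb
    simpa [h] using hflip i (fun x => ! b x)
  have hchargeA : ∀ b i, ψ i b ≠ 0 → ∑ x with x ∈ A, spinSign (b x) = 0 := by
    intro b i hb
    have h1 := hcharge b i hb
    have h2 := hcharge _ i (hswap i b hb)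
    have h3 : ∑ x, (spinSign (b x) - spinSign (if x ∈ A then ! b x else b x)) =
        2 * ∑ x with x ∈ A, spinSign (b x) := by
      rw [Finset.sum_filter, Finset.mul_sum]
      refine Finset.sum_congr rfl fun x _ => ?_
      split_ifs
      · rw [spinSign_not]; ring
      · ring
    rw [Finset.sum_sub_distrib, h1, h2, sub_zero] at h3
    simpa using h3.symm
  have hproper : A ≠ Set.univ := by
    rintro rfl
    obtain ⟨x, hx⟩ := hBne
    exact hAB.notMem_of_mem_right hx (Set.mem_univ x)
  obtain ⟨j, hj, l, hl, hshift⟩ := hA.exists_sum_shift_sub hAne hproper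
  have hends : ∀ b i, ψ i b ≠ 0 → b l = b j := by
    intro b i hb
    have hρ : ρ (fun x => b (x + 1)) (fun x => b (x + 1)) ≠ 0 := by
      rw [← transT_conj_apply ρ b b, hT]
      exact (hdiag b).2 ⟨i, hb⟩
    obtain ⟨k, hk⟩ := (hdiag _).1 hρ
    have h := hshift fun x => spinSign (b x)
    rw [hchargeA b i hb, hchargeA _ k hk, sub_zero] at h
    exact spinSign_injective (sub_eq_zero.1 h.symm)
  obtain ⟨b, hb⟩ : ∃ b, ρ b b ≠ 0 := by
    by_contra! h
    simp [Matrix.trace, h] at htr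
  obtain ⟨i, hi⟩ := (hdiag b).1 hb
  have h1 := hends b i hi
  have h2 := hends _ i (hswap i b hi)
  simp [hj, hl, h1] at h2
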